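/- (Interchange law.) Let S, T, U be spans from A to B and S', T', U' be spans from B to C; let X : S → T, Y : T → U be spans of spans and X' : S' → T', Y' : T' → U' be spans of spans. Then the span of spans (X ×_T Y) ×_B (X' ×_{T'} Y') and the span of spans (X ×_B X') ×_{T ×_B T'} (Y ×_B Y'), each with its induced morphisms to S ×_B S' and U ×_B U', are isomorphic as spans of spans from S ×_B S' to U ×_B U'. That is, (Y ∘ X) ; (Y' ∘ X') = (Y ; Y') ∘ (X ; X'), where ∘ denotes vertical composition by pullback over the intermediate span and ; denotes horizontal composition by pullback over B. -/

import Mathlib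

open CategoryTheory CategoryTheory.Limits

universe v u

/-- A span from `A` to `B` in a category `C`: an object together with morphisms to `A`
and to `B`. -/
structure Span (C : Type u) [Category.{v} C] (A B : C) : Type max u v where
  apex : C
  left : apex ⟶ A
  right : apex ⟶ B

variable {C : Type u} [Category.{v} C]

/-- The identity span `A ← A → A`, both legs the identity. -/
def idSpan (A : C) : Span C A A :=
  ⟨A, 𝟙 A, 𝟙 A⟩

/-- A span of spans from `S` to `T` (spans from `A` to `B`): an object with morphisms to the
apexes of `S` and `T` making both evident squares commute. -/
structure SpanOfSpans {A B : C} (S T : Span C A B) : Type max u v where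
  apex : C
  src : apex ⟶ S.apex
  tgt : apex ⟶ T.apex
  wl : src ≫ S.left = tgt ≫ T.left
  wr : src ≫ S.right = tgt ≫ T.right

/-- Two spans of spans are isomorphic as spans of spans if there is an isomorphism of their
apexes commuting with the morphisms to the two spans. -/
def SOSIso {A B : C} {S T : Span C A B} (X Y : SpanOfSpans S T) : Prop :=
  ∃ e : X.apex ≅ Y.apex, e.hom ≫ Y.src = X.src ∧ e.hom ≫ Y.tgt = X.tgt

/-- The identity span of spans on a span `S`. -/
def idSOS {A B : C} (S : Span C A B) : SpanOfSpans S S :=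
  ⟨S.apex, 𝟙 _, 𝟙 _, rfl, rfl⟩

variable [HasPullbacks C]

/-- Vertical composition of spans of spans, via the pullback over the intermediate span. -/
noncomputable def vcomp {A B : C} {S T U : Span C A B} (X : SpanOfSpans S T) (Y : SpanOfSpans T U) :
    SpanOfSpans S U where
  apex := pullback X.tgt Y.src
  src := pullback.fst X.tgt Y.src ≫ X.src
  tgt := pullback.snd X.tgt Y.src ≫ Y.tgt
  wl := by
    rw [Category.assoc, X.wl, ← Category.assoc, pullback.condition, Category.assoc, Y.wl,
      Category.assoc]
  wr := by
    rw [Category.assoc, X.wr, ← Category.assoc, pullback.condition, Category.assoc, Y.wr,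
      Category.assoc]
/-- Horizontal composition of spans: `S ×_B S'` with its composite legs. -/
noncomputable def hcompSpan {A B D : C} (S : Span C A B) (S' : Span C B D) : Span C A D where
  apex := pullback S.right S'.left
  left := pullback.fst S.right S'.left ≫ S.left
  right := pullback.snd S.right S'.left ≫ S'.right

/-- Horizontal composition of spans of spans, via the pullback over the intermediate object. -/
noncomputable def hcompSOS {A B D : C} {S T : Span C A B} {S' T' : Span C B D}
    (X : SpanOfSpans S T) (X' : SpanOfSpans S' T') :
    SpanOfSpans (hcompSpan S S') (hcompSpan T T') where
  apex := pullback (X.src ≫ S.right) (X'.src ≫ S'.left)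
  src :=
    pullback.lift (pullback.fst (X.src ≫ S.right) (X'.src ≫ S'.left) ≫ X.src)
      (pullback.snd (X.src ≫ S.right) (X'.src ≫ S'.left) ≫ X'.src)
      (by rw [Category.assoc, Category.assoc]; exact pullback.condition)
  tgt :=
    pullback.lift (pullback.fst (X.src ≫ S.right) (X'.src ≫ S'.left) ≫ X.tgt)
      (pullback.snd (X.src ≫ S.right) (X'.src ≫ S'.left) ≫ X'.tgt)
      (by rw [Category.assoc, Category.assoc, ← X.wr, ← X'.wl]; exact pullback.condition)
  wl := by
    simp only [hcompSpan, ← Category.assoc, pullback.lift_fst]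
    simp only [Category.assoc, X.wl]
  wr := by
    simp only [hcompSpan, ← Category.assoc, pullback.lift_snd]
    simp only [Category.assoc, X'.wr]

section Interchange

variable {A B D : C} {S T U : Span C A B} {S₂ T₂ U₂ : Span C B D}
  (X : SpanOfSpans S T) (Y : SpanOfSpans T U)
  (X₂ : SpanOfSpans S₂ T₂) (Y₂ : SpanOfSpans T₂ U₂)

/-- A morphism into the apex of a vertical composite, from morphisms into the two factors. -/
noncomputable def vcompLift {W : C} (f : W ⟶ X.apex) (g : W ⟶ Y.apex)
    (h : f ≫ X.tgt = g ≫ Y.src) : W ⟶ (vcomp X Y).apex :=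
  pullback.lift f g h

/-- The projection from the apex of a vertical composite to its first factor. -/
noncomputable def vcompFst : (vcomp X Y).apex ⟶ X.apex :=
  pullback.fst X.tgt Y.src

/-- The projection from the apex of a vertical composite to its second factor. -/
noncomputable def vcompSnd : (vcomp X Y).apex ⟶ Y.apex :=
  pullback.snd X.tgt Y.src

/-- The projection from a horizontal composite of spans to its first factor. -/
noncomputable def hcompSpanFst (S : Span C A B) (S₂ : Span C B D) :
    (hcompSpan S S₂).apex ⟶ S.apex :=
  pullback.fst S.right S₂.left

/-- The projection from a horizontal composite of spans to its second factor. -/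
noncomputable def hcompSpanSnd (S : Span C A B) (S₂ : Span C B D) :
    (hcompSpan S S₂).apex ⟶ S₂.apex :=
  pullback.snd S.right S₂.left

/-- A morphism into the apex of a horizontal composite of spans of spans. -/
noncomputable def hcompLift {W : C} (f : W ⟶ X.apex) (g : W ⟶ X₂.apex)
    (h : f ≫ X.src ≫ S.right = g ≫ X₂.src ≫ S₂.left) : W ⟶ (hcompSOS X X₂).apex :=
  pullback.lift f g h

/-- The projection from a horizontal composite of spans of spans to its first factor. -/
noncomputable def hcompFst : (hcompSOS X X₂).apex ⟶ X.apex :=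
  pullback.fst (X.src ≫ S.right) (X₂.src ≫ S₂.left)

/-- The projection from a horizontal composite of spans of spans to its second factor. -/
noncomputable def hcompSnd : (hcompSOS X X₂).apex ⟶ X₂.apex :=
  pullback.snd (X.src ≫ S.right) (X₂.src ≫ S₂.left)

@[simp]
lemma vcompLift_fst {W : C} (f : W ⟶ X.apex) (g : W ⟶ Y.apex)
    (h : f ≫ X.tgt = g ≫ Y.src) : vcompLift X Y f g h ≫ vcompFst X Y = f :=
  pullback.lift_fst _ _ _

@[simp]
lemma vcompLift_snd {W : C} (f : W ⟶ X.apex) (g : W ⟶ Y.apex)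
    (h : f ≫ X.tgt = g ≫ Y.src) : vcompLift X Y f g h ≫ vcompSnd X Y = g :=
  pullback.lift_snd _ _ _

@[simp]
lemma hcompLift_fst {W : C} (f : W ⟶ X.apex) (g : W ⟶ X₂.apex)
    (h : f ≫ X.src ≫ S.right = g ≫ X₂.src ≫ S₂.left) :
    hcompLift X X₂ f g h ≫ hcompFst X X₂ = f :=
  pullback.lift_fst _ _ _

@[simp]
lemma hcompLift_snd {W : C} (f : W ⟶ X.apex) (g : W ⟶ X₂.apex)
    (h : f ≫ X.src ≫ S.right = g ≫ X₂.src ≫ S₂.left) :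
    hcompLift X X₂ f g h ≫ hcompSnd X X₂ = g :=
  pullback.lift_snd _ _ _

@[simp]
lemma vcompLift_fst_assoc {W Z : C} (f : W ⟶ X.apex) (g : W ⟶ Y.apex)
    (h : f ≫ X.tgt = g ≫ Y.src) (k : X.apex ⟶ Z) :
    vcompLift X Y f g h ≫ vcompFst X Y ≫ k = f ≫ k := by
  rw [← Category.assoc, vcompLift_fst]

@[simp]
lemma vcompLift_snd_assoc {W Z : C} (f : W ⟶ X.apex) (g : W ⟶ Y.apex)
    (h : f ≫ X.tgt = g ≫ Y.src) (k : Y.apex ⟶ Z) :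
    vcompLift X Y f g h ≫ vcompSnd X Y ≫ k = g ≫ k := by
  rw [← Category.assoc, vcompLift_snd]

@[simp]
lemma hcompLift_fst_assoc {W Z : C} (f : W ⟶ X.apex) (g : W ⟶ X₂.apex)
    (h : f ≫ X.src ≫ S.right = g ≫ X₂.src ≫ S₂.left) (k : X.apex ⟶ Z) :
    hcompLift X X₂ f g h ≫ hcompFst X X₂ ≫ k = f ≫ k := by
  rw [← Category.assoc, hcompLift_fst]

@[simp]
lemma hcompLift_snd_assoc {W Z : C} (f : W ⟶ X.apex) (g : W ⟶ X₂.apex)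
    (h : f ≫ X.src ≫ S.right = g ≫ X₂.src ≫ S₂.left) (k : X₂.apex ⟶ Z) :
    hcompLift X X₂ f g h ≫ hcompSnd X X₂ ≫ k = g ≫ k := by
  rw [← Category.assoc, hcompLift_snd]

lemma vcomp_condition : vcompFst X Y ≫ X.tgt = vcompSnd X Y ≫ Y.src :=
  pullback.condition

lemma hcomp_condition :
    hcompFst X X₂ ≫ X.src ≫ S.right = hcompSnd X X₂ ≫ X₂.src ≫ S₂.left :=
  pullback.condition

lemma vcomp_src : (vcomp X Y).src = vcompFst X Y ≫ X.src := rfl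

lemma vcomp_tgt : (vcomp X Y).tgt = vcompSnd X Y ≫ Y.tgt := rfl

@[simp]
lemma hcompSOS_src_fst :
    (hcompSOS X X₂).src ≫ hcompSpanFst S S₂ = hcompFst X X₂ ≫ X.src :=
  pullback.lift_fst _ _ _

@[simp]
lemma hcompSOS_src_snd :
    (hcompSOS X X₂).src ≫ hcompSpanSnd S S₂ = hcompSnd X X₂ ≫ X₂.src :=
  pullback.lift_snd _ _ _

@[simp]
lemma hcompSOS_tgt_fst :
    (hcompSOS X X₂).tgt ≫ hcompSpanFst T T₂ = hcompFst X X₂ ≫ X.tgt :=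
  pullback.lift_fst _ _ _

@[simp]
lemma hcompSOS_tgt_snd :
    (hcompSOS X X₂).tgt ≫ hcompSpanSnd T T₂ = hcompSnd X X₂ ≫ X₂.tgt :=
  pullback.lift_snd _ _ _

variable {X Y X₂ Y₂}

lemma vcomp_hom_ext {W : C} {f g : W ⟶ (vcomp X Y).apex}
    (h₁ : f ≫ vcompFst X Y = g ≫ vcompFst X Y)
    (h₂ : f ≫ vcompSnd X Y = g ≫ vcompSnd X Y) : f = g :=
  pullback.hom_ext h₁ h₂

lemma hcompSOS_hom_ext {W : C} {f g : W ⟶ (hcompSOS X X₂).apex}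
    (h₁ : f ≫ hcompFst X X₂ = g ≫ hcompFst X X₂)
    (h₂ : f ≫ hcompSnd X X₂ = g ≫ hcompSnd X X₂) : f = g :=
  pullback.hom_ext h₁ h₂

lemma hcompSpan_hom_ext {W : C} {f g : W ⟶ (hcompSpan S S₂).apex}
    (h₁ : f ≫ hcompSpanFst S S₂ = g ≫ hcompSpanFst S S₂)
    (h₂ : f ≫ hcompSpanSnd S S₂ = g ≫ hcompSpanSnd S S₂) : f = g :=
  pullback.hom_ext h₁ h₂

variable (X Y X₂ Y₂)

/-- The comparison `(X ×_T Y) ×_B (X₂ ×_{T₂} Y₂) ⟶ (X ×_B X₂) ×_{T ×_B T₂} (Y ×_B Y₂)`. -/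
noncomputable def interchangeHom :
    (hcompSOS (vcomp X Y) (vcomp X₂ Y₂)).apex ⟶ (vcomp (hcompSOS X X₂) (hcompSOS Y Y₂)).apex :=
  vcompLift _ _
    (hcompLift X X₂ (hcompFst _ _ ≫ vcompFst X Y) (hcompSnd _ _ ≫ vcompFst X₂ Y₂) (by
      simpa [vcomp_src] using hcomp_condition (vcomp X Y) (vcomp X₂ Y₂)))
    (hcompLift Y Y₂ (hcompFst _ _ ≫ vcompSnd X Y) (hcompSnd _ _ ≫ vcompSnd X₂ Y₂) (by
      have h := hcomp_condition (vcomp X Y) (vcomp X₂ Y₂)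
      rw [(vcomp X Y).wr, (vcomp X₂ Y₂).wl] at h
      simpa [vcomp_tgt, Y.wr, Y₂.wl] using h))
    (by apply hcompSpan_hom_ext <;> simp [vcomp_condition])

/-- The comparison `(X ×_B X₂) ×_{T ×_B T₂} (Y ×_B Y₂) ⟶ (X ×_T Y) ×_B (X₂ ×_{T₂} Y₂)`. -/
noncomputable def interchangeInv :
    (vcomp (hcompSOS X X₂) (hcompSOS Y Y₂)).apex ⟶ (hcompSOS (vcomp X Y) (vcomp X₂ Y₂)).apex :=
  hcompLift _ _
    (vcompLift X Y (vcompFst _ _ ≫ hcompFst X X₂) (vcompSnd _ _ ≫ hcompFst Y Y₂) (by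
      simpa using vcomp_condition (hcompSOS X X₂) (hcompSOS Y Y₂) =≫ hcompSpanFst T T₂))
    (vcompLift X₂ Y₂ (vcompFst _ _ ≫ hcompSnd X X₂) (vcompSnd _ _ ≫ hcompSnd Y Y₂) (by
      simpa using vcomp_condition (hcompSOS X X₂) (hcompSOS Y Y₂) =≫ hcompSpanSnd T T₂))
    (by simp [vcomp_src, hcomp_condition])

/-- The interchange isomorphism between the two composites of four spans of spans. -/
noncomputable def interchangeIso :
    (hcompSOS (vcomp X Y) (vcomp X₂ Y₂)).apex ≅ (vcomp (hcompSOS X X₂) (hcompSOS Y Y₂)).apex where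
  hom := interchangeHom X Y X₂ Y₂
  inv := interchangeInv X Y X₂ Y₂
  hom_inv_id := by
    apply hcompSOS_hom_ext <;> apply vcomp_hom_ext <;> simp [interchangeHom, interchangeInv]
  inv_hom_id := by
    apply vcomp_hom_ext <;> apply hcompSOS_hom_ext <;> simp [interchangeHom, interchangeInv]

end Interchange

/-- The interchange law: for spans of spans `X : S → T`, `Y : T → U` (between spans from `A`
to `B`) and `X' : S' → T'`, `Y' : T' → U'` (between spans from `B` to `D`), the horizontal
composite of the vertical composites, `(X ×_T Y) ×_B (X' ×_{T'} Y')`, and the vertical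
composite of the horizontal composites, `(X ×_B X') ×_{T ×_B T'} (Y ×_B Y')`, are isomorphic
as spans of spans from `S ×_B S'` to `U ×_B U'`; that is,
`(Y ∘ X) ; (Y' ∘ X') = (Y ; Y') ∘ (X ; X')`. -/
theorem interchange_sosIso {A B D : C} {S T U : Span C A B} {S' T' U' : Span C B D}
    (X : SpanOfSpans S T) (Y : SpanOfSpans T U)
    (X' : SpanOfSpans S' T') (Y' : SpanOfSpans T' U') :
    SOSIso (hcompSOS (vcomp X Y) (vcomp X' Y'))
      (vcomp (hcompSOS X X') (hcompSOS Y Y')) := by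
  refine ⟨interchangeIso X Y X' Y', ?_, ?_⟩ <;> apply hcompSpan_hom_ext <;>
    simp [interchangeIso, interchangeHom, vcomp_src, vcomp_tgt]
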